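/- Let E be a real normed space, U ⊆ E open, and J : U → (E →L[ℝ] E) differentiable with (J x) ∘ (J x) = −id on U, symmetric derivative ((fderiv ℝ J x u) v = (fderiv ℝ J x v) u), and conical condition fderiv ℝ J x x = 0 for all x ∈ U. On Ω := U × E define the vector field W(x,y) := (2 (J x) x, 0) and, for fixed u, v ∈ E, the vector fields P₁(x,y) := ((J x) u, −(J x) v), P₂(x,y) := (v, −u), P₃(x,y) := ((J x) v, (J x) u), and the constant field C(x,y) := (u,v). Then for every p = (x,y) ∈ Ω: [W, P₁](p) − I₁ᵖ([W, C](p)) = 0 and [W, P₂](p) − I₂([W, C](p)) = −2 P₃(p), where I₁ᵖ(a,b) := ((J x) a, −(J x) b), I₂(a,b) := (b, −a), and [V₁,V₂](p) := fderiv ℝ V₂ p (V₁ p) − fderiv ℝ V₁ p (V₂ p). In other words, L_{Z^M} I₁ = 0 and L_{Z^M} I₂ = −2 I₃ for Z^M := 2 Z^{h_∇} with Z = Jξ, i.e. Z^M is a rotating vector field on TN. -/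

import Mathlib

/-- The Lie bracket of vector fields on an open subset of a normed space,
`[V₁,V₂](x) = fderiv ℝ V₂ x (V₁ x) − fderiv ℝ V₁ x (V₂ x)`. -/
noncomputable def vfLieBracket {F : Type*} [NormedAddCommGroup F] [NormedSpace ℝ F]
    (V₁ V₂ : F → F) (x : F) : F :=
  fderiv ℝ V₂ x (V₁ x) - fderiv ℝ V₁ x (V₂ x)

/-- Differentiating `J² = -1` shows that `J` anticommutes with its derivative. -/
theorem fderiv_apply_of_apply_apply_eq_neg
    {E : Type*} [NormedAddCommGroup E] [NormedSpace ℝ E]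
    {U : Set E} (hU : IsOpen U) {J : E → (E →L[ℝ] E)}
    (hJ : ∀ x ∈ U, ∀ v : E, J x (J x v) = -v)
    {x : E} (hx : x ∈ U) (hdiff : DifferentiableAt ℝ J x) (u w : E) :
    fderiv ℝ J x u (J x w) = -(J x (fderiv ℝ J x u w)) := by
  have h₁ := hdiff.hasFDerivAt.clm_apply
    (hdiff.hasFDerivAt.clm_apply (hasFDerivAt_const w x))
  have h₂ : (fun y => J y (J y w)) =ᶠ[nhds x] fun _ => -w :=
    Filter.eventually_of_mem (hU.mem_nhds hx) fun y hy => hJ y hy w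
  have h₃ := h₁.unique ((hasFDerivAt_const (-w) x).congr_of_eventuallyEq h₂)
  have h₄ := congrArg (fun L : E →L[ℝ] E => L u) h₃
  exact eq_neg_of_add_eq_zero_right (by simpa using h₄)

/-- `Z^M = 2 Z^{h_∇}`, `Z = Jξ`, is a rotating vector field on `TN`:
`L_{Z^M} I₁ = 0` and `L_{Z^M} I₂ = −2 I₃`, in affine coordinates on `TN = U × E`. -/
theorem rotating_field_on_tangent_bundle
    {E : Type*} [NormedAddCommGroup E] [NormedSpace ℝ E]
    (U : Set E) (hU : IsOpen U)
    (J : E → (E →L[ℝ] E))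
    (hdiff : ∀ x ∈ U, DifferentiableAt ℝ J x)
    (hJ : ∀ x ∈ U, ∀ v : E, J x (J x v) = -v)
    (hsym : ∀ x ∈ U, ∀ u v : E, fderiv ℝ J x u v = fderiv ℝ J x v u)
    (hconical : ∀ x ∈ U, fderiv ℝ J x x = 0)
    (W P₁ P₂ P₃ C : E → E → (E × E) → (E × E))
    (hW : ∀ u v : E, ∀ p : E × E, W u v p = ((2 : ℝ) • J p.1 p.1, 0))
    (hP₁ : ∀ u v : E, ∀ p : E × E, P₁ u v p = (J p.1 u, -(J p.1 v)))
    (hP₂ : ∀ u v : E, ∀ p : E × E, P₂ u v p = (v, -u))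
    (hP₃ : ∀ u v : E, ∀ p : E × E, P₃ u v p = (J p.1 v, J p.1 u))
    (hC : ∀ u v : E, ∀ p : E × E, C u v p = (u, v)) :
    ∀ u v : E, ∀ p : E × E, p.1 ∈ U →
      (vfLieBracket (W u v) (P₁ u v) p
          - (J p.1 (vfLieBracket (W u v) (C u v) p).1,
             -(J p.1 (vfLieBracket (W u v) (C u v) p).2)) = 0) ∧
      (vfLieBracket (W u v) (P₂ u v) p
          - ((vfLieBracket (W u v) (C u v) p).2,
             -(vfLieBracket (W u v) (C u v) p).1)
        = -(2 : ℝ) • P₃ u v p) := by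
  intro u v p hp
  have hJp := (hdiff p.1 hp).hasFDerivAt
  have hfst : HasFDerivAt (fun q : E × E => q.1) (ContinuousLinearMap.fst ℝ E E) p :=
    hasFDerivAt_fst
  have hJfst : HasFDerivAt (fun q : E × E => J q.1)
      ((fderiv ℝ J p.1).comp (ContinuousLinearMap.fst ℝ E E)) p :=
    hJp.comp p hfst
  have hradial (a : E) : fderiv ℝ J p.1 a p.1 = 0 := by
    rw [hsym p.1 hp, hconical p.1 hp, zero_apply]
  have hJradial (a : E) : fderiv ℝ J p.1 (J p.1 p.1) a = 0 := by
    rw [hsym p.1 hp, fderiv_apply_of_apply_apply_eq_neg hU hJ hp (hdiff p.1 hp), hradial,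
      map_zero, neg_zero]
  have hWd (a : E × E) : fderiv ℝ (W u v) p a = ((2 : ℝ) • J p.1 a.1, 0) := by
    rw [funext (hW u v), (((hJfst.clm_apply hfst).fun_const_smul (2 : ℝ)).prodMk
      (hasFDerivAt_const (0 : E) p)).fderiv]
    simp [hradial]
  have hP₁d : fderiv ℝ (P₁ u v) p (W u v p) = 0 := by
    rw [funext (hP₁ u v), ((hJfst.clm_apply (hasFDerivAt_const u p)).prodMk
      (hJfst.clm_apply (hasFDerivAt_const v p)).fun_neg).fderiv]
    simp [hW, hJradial]
  have hP₂d : fderiv ℝ (P₂ u v) p = 0 := by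
    rw [funext (hP₂ u v)]; exact fderiv_const_apply _
  have hCd : fderiv ℝ (C u v) p = 0 := by
    rw [funext (hC u v)]; exact fderiv_const_apply _
  simp only [vfLieBracket, hWd, hP₁d, hP₂d, hCd, hP₁, hP₂, hP₃, hC]
  constructor <;> simp
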